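/- (Solution of the homogeneous equation, case k = 2.) A differentiable function f : U → ℝ satisfies −g''(u) + f'(u)·g(u) + f(u)·g'(u) = 0 for all u ∈ U if and only if there exists a constant b ∈ ℝ such that f(u) = (g'(u) + b)/g(u) for all u ∈ U; moreover, in that case f(u) = (1 + b·(n−1)/(n−2))·F'(u)/F(u) − F''(u)/F'(u) for all u ∈ U. -/

import Mathlib

/-- The function `g = ((n−2)F)/((n−1)F')`. -/
noncomputable def gFun (n : ℕ) (F : ℝ → ℝ) (u : ℝ) : ℝ :=
  (((n : ℝ) - 2) * F u) / (((n : ℝ) - 1) * deriv F u)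

theorem hasDerivAt_gFun {n : ℕ} (hn : 4 ≤ n) {F : ℝ → ℝ} {u : ℝ}
    (hF : DifferentiableAt ℝ F u) (hF' : DifferentiableAt ℝ (deriv F) u)
    (hne : deriv F u ≠ 0) :
    HasDerivAt (gFun n F)
      (((n : ℝ) - 2) / ((n : ℝ) - 1) * (1 - F u * deriv (deriv F) u / deriv F u ^ 2)) u := by
  have hn' : (4 : ℝ) ≤ n := by exact_mod_cast hn
  have h1 : (n : ℝ) - 1 ≠ 0 := by linarith
  have h := (hF.hasDerivAt.const_mul ((n : ℝ) - 2)).div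
    (hF'.hasDerivAt.const_mul ((n : ℝ) - 1)) (mul_ne_zero h1 hne)
  refine HasDerivAt.congr_deriv (f := gFun n F) h ?_
  field_simp

theorem gFun_ne_zero {n : ℕ} (hn : 4 ≤ n) {F : ℝ → ℝ} {u : ℝ}
    (hF : F u ≠ 0) (hF' : deriv F u ≠ 0) : gFun n F u ≠ 0 := by
  have hn' : (4 : ℝ) ≤ n := by exact_mod_cast hn
  exact div_ne_zero (mul_ne_zero (by linarith) hF) (mul_ne_zero (by linarith) hF')

theorem differentiableAt_deriv_gFun {n : ℕ} (hn : 4 ≤ n) {U : Set ℝ} (hU : IsOpen U)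
    {F : ℝ → ℝ}
    (hF₁ : ∀ u ∈ U, DifferentiableAt ℝ F u)
    (hF₂ : ∀ u ∈ U, DifferentiableAt ℝ (deriv F) u)
    (hF₃ : ∀ u ∈ U, DifferentiableAt ℝ (deriv (deriv F)) u)
    (hne : ∀ u ∈ U, deriv F u ≠ 0) {u : ℝ} (hu : u ∈ U) :
    DifferentiableAt ℝ (deriv (gFun n F)) u := by
  have h : DifferentiableAt ℝ (fun v => ((n : ℝ) - 2) / ((n : ℝ) - 1) *
      (1 - F v * deriv (deriv F) v / deriv F v ^ 2)) u :=
    ((differentiableAt_const 1).sub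
      (((hF₁ u hu).mul (hF₃ u hu)).div ((hF₂ u hu).pow 2) (pow_ne_zero 2 (hne u hu)))).const_mul _
  refine h.congr_of_eventuallyEq ?_
  filter_upwards [hU.mem_nhds hu] with v hv
  exact (hasDerivAt_gFun hn (hF₁ v hv) (hF₂ v hv) (hne v hv)).deriv

theorem stmt14 (n : ℕ) (hn : 4 ≤ n)
    (U : Set ℝ) (hU : IsOpen U) (hUc : U.OrdConnected)
    (F : ℝ → ℝ)
    (hF₁ : ∀ u ∈ U, DifferentiableAt ℝ F u)
    (hF₂ : ∀ u ∈ U, DifferentiableAt ℝ (deriv F) u)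
    (hF₃ : ∀ u ∈ U, DifferentiableAt ℝ (deriv (deriv F)) u)
    (hFne : ∀ u ∈ U, F u ≠ 0)
    (hF'pos : ∀ u ∈ U, 0 < deriv F u)
    (f : ℝ → ℝ) (hf : ∀ u ∈ U, DifferentiableAt ℝ f u) :
    ((∀ u ∈ U,
        -(deriv (deriv (gFun n F)) u) + deriv f u * gFun n F u
          + f u * deriv (gFun n F) u = 0) ↔
      ∃ b : ℝ, ∀ u ∈ U, f u = (deriv (gFun n F) u + b) / gFun n F u) ∧
    (∀ b : ℝ, (∀ u ∈ U, f u = (deriv (gFun n F) u + b) / gFun n F u) →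
      ∀ u ∈ U,
        f u = (1 + b * (((n : ℝ) - 1) / ((n : ℝ) - 2))) * deriv F u / F u
          - deriv (deriv F) u / deriv F u) := by
  have hne : ∀ u ∈ U, deriv F u ≠ 0 := fun u hu => (hF'pos u hu).ne'
  have hg : ∀ u ∈ U, gFun n F u ≠ 0 := fun u hu => gFun_ne_zero hn (hFne u hu) (hne u hu)
  have hderiv : ∀ u ∈ U, HasDerivAt (fun v => f v * gFun n F v - deriv (gFun n F) v)
      (-(deriv (deriv (gFun n F)) u) + deriv f u * gFun n F u
        + f u * deriv (gFun n F) u) u := by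
    intro u hu
    have h := ((hf u hu).hasDerivAt.mul
      (hasDerivAt_gFun hn (hF₁ u hu) (hF₂ u hu)
        (hne u hu)).differentiableAt.hasDerivAt).sub
      (differentiableAt_deriv_gFun hn hU hF₁ hF₂ hF₃ hne hu).hasDerivAt
    exact h.congr_deriv (by ring)
  refine ⟨⟨fun h => ?_, ?_⟩, ?_⟩
  · obtain ⟨b, hb⟩ := hU.exists_is_const_of_deriv_eq_zero hUc.isPreconnected
      (fun u hu => (hderiv u hu).differentiableAt.differentiableWithinAt)
      (fun u hu => (hderiv u hu).deriv.trans (h u hu))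
    refine ⟨b, fun u hu => ?_⟩
    rw [eq_div_iff (hg u hu)]
    linarith [hb u hu]
  · rintro ⟨b, hb⟩ u hu
    refine (hderiv u hu).unique ((hasDerivAt_const u b).congr_of_eventuallyEq ?_)
    filter_upwards [hU.mem_nhds hu] with v hv
    have := (eq_div_iff (hg v hv)).1 (hb v hv)
    linarith
  · intro b hb u hu
    have hn' : (4 : ℝ) ≤ n := by exact_mod_cast hn
    have h1 : (n : ℝ) - 1 ≠ 0 := by linarith
    have h2 : (n : ℝ) - 2 ≠ 0 := by linarith
    have hF := hFne u hu
    have hF' := hne u hu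
    rw [hb u hu, (hasDerivAt_gFun hn (hF₁ u hu) (hF₂ u hu) hF').deriv, gFun]
    field_simp
    ring
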